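/- arXiv:1610.06999 — 4 statements merged into one kernel-verified Lean document; each statement's English description precedes it below -/
import Mathlib

section
/- Along any trajectory of the mechanical system with inner-loop control u(t) := τ(t) − ∇V_a(q_a(t)), the storage function H_u satisfies d/dt H_u(q_u(t), q̇_u(t)) = u(t)ᵀ y_u(t) for all t ≥ 0; consequently, since H_u is bounded from below, the map u ↦ y_u is passive: for every trajectory there exists β ∈ ℝ with ∫₀ᵗ u(s)ᵀ y_u(s) ds ≥ β for all t ≥ 0. (Proposition 1, unactuated output.) -/
open Matrix Set Filter

noncomputable section

/-- Componentwise gradient of a scalar function on `Fin k → ℝ`. -/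
def grad {k : ℕ} (f : (Fin k → ℝ) → ℝ) (x : Fin k → ℝ) : Fin k → ℝ :=
  fun i => fderiv ℝ f x (Pi.single i 1)

/-- The block inertia matrix `M(q_u) = [[m_uu, m_auᵀ], [m_au, m_aa]]`. -/
def Mblk {s m : ℕ} (muu : (Fin s → ℝ) → Matrix (Fin s) (Fin s) ℝ)
    (mau : (Fin s → ℝ) → Matrix (Fin m) (Fin s) ℝ)
    (maa : Matrix (Fin m) (Fin m) ℝ) (qu : Fin s → ℝ) :
    Matrix (Fin s ⊕ Fin m) (Fin s ⊕ Fin m) ℝ :=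
  Matrix.fromBlocks (muu qu) (mau qu)ᵀ (mau qu) maa

/-- The Jacobian `J(q, v)` (w.r.t. `q`) of the map `q ↦ M(q_u) v`. -/
def Jmat {s m : ℕ} (muu : (Fin s → ℝ) → Matrix (Fin s) (Fin s) ℝ)
    (mau : (Fin s → ℝ) → Matrix (Fin m) (Fin s) ℝ)
    (maa : Matrix (Fin m) (Fin m) ℝ)
    (q v : (Fin s ⊕ Fin m) → ℝ) :
    Matrix (Fin s ⊕ Fin m) (Fin s ⊕ Fin m) ℝ :=
  fun i j =>
    fderiv ℝ (fun p : (Fin s ⊕ Fin m) → ℝ =>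
      (Mblk muu mau maa (p ∘ Sum.inl) *ᵥ v) i) q (Pi.single j 1)

/-- The Coriolis force vector `C(q, q̇) q̇ = [J(q,q̇) − ½ J(q,q̇)ᵀ] q̇`. -/
def Cvec {s m : ℕ} (muu : (Fin s → ℝ) → Matrix (Fin s) (Fin s) ℝ)
    (mau : (Fin s → ℝ) → Matrix (Fin m) (Fin s) ℝ)
    (maa : Matrix (Fin m) (Fin m) ℝ)
    (q v : (Fin s ⊕ Fin m) → ℝ) : (Fin s ⊕ Fin m) → ℝ :=
  (Jmat muu mau maa q v - (1/2 : ℝ) • (Jmat muu mau maa q v)ᵀ) *ᵥ v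

/-- The Schur complement `m_uu^s(q_u) = m_uu − m_auᵀ m_aa⁻¹ m_au`. -/
def muuS {s m : ℕ} (muu : (Fin s → ℝ) → Matrix (Fin s) (Fin s) ℝ)
    (mau : (Fin s → ℝ) → Matrix (Fin m) (Fin s) ℝ)
    (maa : Matrix (Fin m) (Fin m) ℝ) (qu : Fin s → ℝ) : Matrix (Fin s) (Fin s) ℝ :=
  muu qu - (mau qu)ᵀ * maa⁻¹ * mau qu

/-- `M_a(q_u) = [[m_auᵀ m_aa⁻¹ m_au, m_auᵀ], [m_au, m_aa]]`. -/
def MaMat {s m : ℕ} (mau : (Fin s → ℝ) → Matrix (Fin m) (Fin s) ℝ)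
    (maa : Matrix (Fin m) (Fin m) ℝ) (qu : Fin s → ℝ) :
    Matrix (Fin s ⊕ Fin m) (Fin s ⊕ Fin m) ℝ :=
  Matrix.fromBlocks ((mau qu)ᵀ * maa⁻¹ * mau qu) (mau qu)ᵀ (mau qu) maa

/-- Storage function `H_u(q_u, q̇_u) = ½ q̇_uᵀ m_uu^s(q_u) q̇_u + V_u(q_u)`. -/
def Hu {s m : ℕ} (muu : (Fin s → ℝ) → Matrix (Fin s) (Fin s) ℝ)
    (mau : (Fin s → ℝ) → Matrix (Fin m) (Fin s) ℝ)
    (maa : Matrix (Fin m) (Fin m) ℝ) (Vu : (Fin s → ℝ) → ℝ)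
    (qu vu : Fin s → ℝ) : ℝ :=
  (1/2 : ℝ) * (vu ⬝ᵥ muuS muu mau maa qu *ᵥ vu) + Vu qu

/-- Storage function `H_a(q_u, q̇) = ½ q̇ᵀ M_a(q_u) q̇`. -/
def Ha {s m : ℕ} (mau : (Fin s → ℝ) → Matrix (Fin m) (Fin s) ℝ)
    (maa : Matrix (Fin m) (Fin m) ℝ) (qu : Fin s → ℝ)
    (qdot : (Fin s ⊕ Fin m) → ℝ) : ℝ :=
  (1/2 : ℝ) * (qdot ⬝ᵥ MaMat mau maa qu *ᵥ qdot)

/-- Passive output `y_u = −m_aa⁻¹ m_au(q_u) q̇_u`. -/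
def yU {s m : ℕ} (mau : (Fin s → ℝ) → Matrix (Fin m) (Fin s) ℝ)
    (maa : Matrix (Fin m) (Fin m) ℝ) (qu vu : Fin s → ℝ) : Fin m → ℝ :=
  -(maa⁻¹ *ᵥ (mau qu *ᵥ vu))

/-- Passive output `y_a = m_aa⁻¹ m_au(q_u) q̇_u + q̇_a`. -/
def yA {s m : ℕ} (mau : (Fin s → ℝ) → Matrix (Fin m) (Fin s) ℝ)
    (maa : Matrix (Fin m) (Fin m) ℝ) (qu vu : Fin s → ℝ) (va : Fin m → ℝ) : Fin m → ℝ :=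
  maa⁻¹ *ᵥ (mau qu *ᵥ vu) + va

theorem HasDerivWithinAt.dotProduct {ι : Type*} [Fintype ι] {f g : ℝ → ι → ℝ} {f' g' : ι → ℝ}
    {S : Set ℝ} {t : ℝ} (hf : HasDerivWithinAt f f' S t) (hg : HasDerivWithinAt g g' S t) :
    HasDerivWithinAt (fun r => f r ⬝ᵥ g r) (f' ⬝ᵥ g t + f t ⬝ᵥ g') S t := by
  simp only [_root_.dotProduct, ← Finset.sum_add_distrib]
  exact HasDerivWithinAt.fun_sum fun i _ =>
    (hasDerivWithinAt_pi.1 hf i).mul (hasDerivWithinAt_pi.1 hg i)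

theorem HasDerivWithinAt.const_mulVec {ι κ : Type*} [Fintype ι] [Fintype κ] (A : Matrix κ ι ℝ)
    {f : ℝ → ι → ℝ} {f' : ι → ℝ} {S : Set ℝ} {t : ℝ} (hf : HasDerivWithinAt f f' S t) :
    HasDerivWithinAt (fun r => A *ᵥ f r) (A *ᵥ f') S t :=
  (LinearMap.toContinuousLinearMap A.mulVecLin).hasFDerivAt.comp_hasDerivWithinAt t hf

theorem clm_apply_eq_sum_single {ι : Type*} [Fintype ι] [DecidableEq ι] (L : (ι → ℝ) →L[ℝ] ℝ)
    (v : ι → ℝ) : L v = ∑ j, L (Pi.single j 1) * v j := by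
  conv_lhs => rw [pi_eq_sum_univ' v]
  simp [map_sum, mul_comm]

theorem grad_dotProduct {k : ℕ} (f : (Fin k → ℝ) → ℝ) (x v : Fin k → ℝ) :
    grad f x ⬝ᵥ v = fderiv ℝ f x v :=
  (clm_apply_eq_sum_single _ v).symm

theorem continuous_grad {k : ℕ} {f : (Fin k → ℝ) → ℝ} (hf : ContDiff ℝ (⊤ : ℕ∞) f) :
    Continuous (grad f) :=
  continuous_pi fun _ => (hf.continuous_fderiv (by simp)).clm_apply continuous_const

section Inertia

variable {s m : ℕ} {muu : (Fin s → ℝ) → Matrix (Fin s) (Fin s) ℝ}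
  {mau : (Fin s → ℝ) → Matrix (Fin m) (Fin s) ℝ} {maa : Matrix (Fin m) (Fin m) ℝ}

/-- The projection of a configuration onto its unactuated coordinates. -/
def unactuatedProj (s m : ℕ) : ((Fin s ⊕ Fin m) → ℝ) →L[ℝ] (Fin s → ℝ) :=
  ContinuousLinearMap.pi fun i => ContinuousLinearMap.proj (Sum.inl i)

theorem differentiable_Mblk_apply (hmuu : ∀ i j, ContDiff ℝ (⊤ : ℕ∞) fun x => muu x i j)
    (hmau : ∀ i j, ContDiff ℝ (⊤ : ℕ∞) fun x => mau x i j) (i j : Fin s ⊕ Fin m) :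
    Differentiable ℝ fun x => Mblk muu mau maa x i j := by
  rcases i with i | i <;> rcases j with j | j
  · exact (hmuu i j).differentiable (by simp)
  · exact (hmau j i).differentiable (by simp)
  · exact (hmau i j).differentiable (by simp)
  · exact differentiable_const _

theorem hasFDerivAt_Mblk_mulVec
    (hN : ∀ i j, Differentiable ℝ fun x => Mblk muu mau maa x i j)
    (q v : (Fin s ⊕ Fin m) → ℝ) (i : Fin s ⊕ Fin m) :
    HasFDerivAt (fun p : (Fin s ⊕ Fin m) → ℝ => (Mblk muu mau maa (p ∘ Sum.inl) *ᵥ v) i)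
      (∑ j, v j • (fderiv ℝ (fun x => Mblk muu mau maa x i j) (q ∘ Sum.inl)).comp
        (unactuatedProj s m)) q := by
  simp only [mulVec, dotProduct]
  refine HasFDerivAt.fun_sum fun j _ => ?_
  exact (((hN i j).differentiableAt (x := unactuatedProj s m q)).hasFDerivAt.comp q
    (unactuatedProj s m).hasFDerivAt).mul_const (v j)

theorem Jmat_mulVec (hN : ∀ i j, Differentiable ℝ fun x => Mblk muu mau maa x i j)
    (q v w : (Fin s ⊕ Fin m) → ℝ) (i : Fin s ⊕ Fin m) :
    (Jmat muu mau maa q v *ᵥ w) i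
      = ∑ j, fderiv ℝ (fun x => Mblk muu mau maa x i j) (q ∘ Sum.inl) (w ∘ Sum.inl) * v j := by
  have h : (Jmat muu mau maa q v *ᵥ w) i
      = fderiv ℝ (fun p : (Fin s ⊕ Fin m) → ℝ =>
        (Mblk muu mau maa (p ∘ Sum.inl) *ᵥ v) i) q w :=
    (clm_apply_eq_sum_single _ w).symm
  rw [h, (hasFDerivAt_Mblk_mulVec hN q v i).fderiv]
  simp only [_root_.sum_apply, _root_.smul_apply, smul_eq_mul,
    ContinuousLinearMap.comp_apply]
  exact Finset.sum_congr rfl fun j _ => mul_comm _ _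

/-- The inertia matrix does not depend on the actuated coordinates. -/
theorem Jmat_inr (hN : ∀ i j, Differentiable ℝ fun x => Mblk muu mau maa x i j)
    (q v : (Fin s ⊕ Fin m) → ℝ) (i : Fin s ⊕ Fin m) (k : Fin m) :
    Jmat muu mau maa q v i (Sum.inr k) = 0 := by
  have h0 : unactuatedProj s m (Pi.single (Sum.inr k) 1) = 0 := by
    ext j
    simp [unactuatedProj]
  rw [Jmat, (hasFDerivAt_Mblk_mulVec hN q v i).fderiv]
  simp [h0]

theorem Cvec_inr (hN : ∀ i j, Differentiable ℝ fun x => Mblk muu mau maa x i j)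
    (q v : (Fin s ⊕ Fin m) → ℝ) (k : Fin m) :
    Cvec muu mau maa q v (Sum.inr k) = (Jmat muu mau maa q v *ᵥ v) (Sum.inr k) := by
  have h0 : ((Jmat muu mau maa q v)ᵀ *ᵥ v) (Sum.inr k) = 0 := by
    simp [mulVec, dotProduct, Jmat_inr hN]
  simp [Cvec, sub_mulVec, smul_mulVec, h0]

theorem dotProduct_Cvec (q v : (Fin s ⊕ Fin m) → ℝ) :
    v ⬝ᵥ Cvec muu mau maa q v = (1 / 2 : ℝ) * (v ⬝ᵥ Jmat muu mau maa q v *ᵥ v) := by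
  have h : v ⬝ᵥ (Jmat muu mau maa q v)ᵀ *ᵥ v = v ⬝ᵥ Jmat muu mau maa q v *ᵥ v := by
    rw [mulVec_transpose, dotProduct_comm, dotProduct_mulVec]
  rw [Cvec, sub_mulVec, smul_mulVec, dotProduct_sub, dotProduct_smul, h, smul_eq_mul]
  ring

/-- Derivative of the generalized momentum along a curve. -/
theorem hasDerivWithinAt_momentum
    (hN : ∀ i j, Differentiable ℝ fun x => Mblk muu mau maa x i j)
    {q qd : ℝ → (Fin s ⊕ Fin m) → ℝ} {a : (Fin s ⊕ Fin m) → ℝ} {S : Set ℝ} {t : ℝ}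
    (hq : HasDerivWithinAt q (qd t) S t) (hqd : HasDerivWithinAt qd a S t) :
    HasDerivWithinAt (fun r => Mblk muu mau maa (q r ∘ Sum.inl) *ᵥ qd r)
      (Mblk muu mau maa (q t ∘ Sum.inl) *ᵥ a + Jmat muu mau maa (q t) (qd t) *ᵥ qd t) S t := by
  refine hasDerivWithinAt_pi.2 fun i => ?_
  rw [Pi.add_apply, Jmat_mulVec hN, add_comm]
  simp only [mulVec, dotProduct, ← Finset.sum_add_distrib]
  refine HasDerivWithinAt.fun_sum fun j _ => ?_
  have hqu : HasDerivWithinAt (fun r => q r ∘ Sum.inl) (qd t ∘ Sum.inl) S t :=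
    (unactuatedProj s m).hasFDerivAt.comp_hasDerivWithinAt t hq
  exact ((hN i j).differentiableAt.hasFDerivAt.comp_hasDerivWithinAt t hqu).mul
    (hasDerivWithinAt_pi.1 hqd j)

theorem maa_posDef (hM : ∀ qu, (Mblk muu mau maa qu).PosDef) : maa.PosDef :=
  (hM 0).submatrix Sum.inr_injective

/-- The Schur complement is positive semidefinite, so `Hu` inherits lower bounds of `Vu`. -/
theorem le_Hu (hM : ∀ qu, (Mblk muu mau maa qu).PosDef) {Vu : (Fin s → ℝ) → ℝ} {c : ℝ}
    (hc : ∀ x, c ≤ Vu x) (x v : Fin s → ℝ) : c ≤ Hu muu mau maa Vu x v := by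
  have hD := maa_posDef hM
  have : Invertible maa := hD.isUnit.invertible
  have hps : (muuS muu mau maa x).PosSemidef := by
    have h := (PosDef.fromBlocks₂₂ (muu x) (mau x)ᵀ hD).1 (by
      simpa [Mblk] using (hM x).posSemidef)
    simpa [muuS] using h
  have h0 := hps.dotProduct_mulVec_nonneg v
  simp only [star_trivial] at h0
  have := hc x
  unfold Hu
  linarith

/-- Completing the square in the actuated momentum. -/
theorem dotProduct_muuS (hM : ∀ qu, (Mblk muu mau maa qu).PosDef) (hmaa : maa.IsSymm)
    (x : Fin s → ℝ) (v : (Fin s ⊕ Fin m) → ℝ) :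
    (v ∘ Sum.inl) ⬝ᵥ muuS muu mau maa x *ᵥ (v ∘ Sum.inl)
      = v ⬝ᵥ Mblk muu mau maa x *ᵥ v
        - ((Mblk muu mau maa x *ᵥ v) ∘ Sum.inr) ⬝ᵥ
          maa⁻¹ *ᵥ ((Mblk muu mau maa x *ᵥ v) ∘ Sum.inr) := by
  have hdet : IsUnit maa.det := (isUnit_iff_isUnit_det _).1 (maa_posDef hM).isUnit
  obtain ⟨a, b, rfl⟩ : ∃ a b, v = Sum.elim a b := ⟨_, _, (Sum.elim_comp_inl_inr v).symm⟩
  have hw : maa⁻¹ *ᵥ (maa *ᵥ b) = b := by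
    rw [mulVec_mulVec, nonsing_inv_mul _ hdet, one_mulVec]
  have hcross : (maa *ᵥ b) ⬝ᵥ maa⁻¹ *ᵥ (mau x *ᵥ a) = b ⬝ᵥ mau x *ᵥ a := by
    rw [← vecMul_transpose, hmaa.eq, ← dotProduct_mulVec, mulVec_mulVec,
      mul_nonsing_inv _ hdet, one_mulVec]
  have hT : a ⬝ᵥ (mau x)ᵀ *ᵥ b = b ⬝ᵥ mau x *ᵥ a := by
    rw [mulVec_transpose, dotProduct_comm, dotProduct_mulVec]
  have hS : a ⬝ᵥ ((mau x)ᵀ * maa⁻¹ * mau x) *ᵥ a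
      = (mau x *ᵥ a) ⬝ᵥ maa⁻¹ *ᵥ (mau x *ᵥ a) := by
    rw [← mulVec_mulVec, ← mulVec_mulVec, dotProduct_mulVec, vecMul_transpose]
  simp only [Mblk, muuS, fromBlocks_mulVec, Sum.elim_comp_inl, Sum.elim_comp_inr,
    sumElim_dotProduct_sumElim, sub_mulVec, dotProduct_sub, dotProduct_add, add_dotProduct,
    mulVec_add, hw, hcross, hT, hS]
  rw [dotProduct_comm (maa *ᵥ b) b, dotProduct_comm (mau x *ᵥ a) b]
  ring

theorem continuousOn_supplyRate (hmau : ∀ i j, ContDiff ℝ (⊤ : ℕ∞) fun x => mau x i j)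
    {Va : (Fin m → ℝ) → ℝ} (hVa : ContDiff ℝ (⊤ : ℕ∞) Va)
    {q qd : ℝ → (Fin s ⊕ Fin m) → ℝ} {τ : ℝ → Fin m → ℝ} {S : Set ℝ}
    (hq : ContinuousOn q S) (hqd : ContinuousOn qd S) (hτ : ContinuousOn τ S) :
    ContinuousOn (fun σ => (τ σ - grad Va (q σ ∘ Sum.inr)) ⬝ᵥ
      yU mau maa (q σ ∘ Sum.inl) (qd σ ∘ Sum.inl)) S := by
  have hmauc : Continuous mau :=
    continuous_pi fun i => continuous_pi fun j => (hmau i j).continuous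
  rw [continuousOn_iff_continuous_domRestrict] at *
  have hqa : Continuous fun σ : S => q σ ∘ Sum.inr :=
    continuous_pi fun i => (continuous_apply (Sum.inr i)).comp hq
  have hqu : Continuous fun σ : S => q σ ∘ Sum.inl :=
    continuous_pi fun i => (continuous_apply (Sum.inl i)).comp hq
  have hvu : Continuous fun σ : S => qd σ ∘ Sum.inl :=
    continuous_pi fun i => (continuous_apply (Sum.inl i)).comp hqd
  exact (hτ.sub ((continuous_grad hVa).comp hqa)).dotProduct
    (continuous_const.matrix_mulVec ((hmauc.comp hqu).matrix_mulVec hvu)).neg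

end Inertia

/-- Proposition 1, unactuated output: along any trajectory with inner-loop
control `u = τ − ∇V_a(q_a)`, `d/dt H_u = uᵀ y_u`; since `H_u` is bounded below, the map
`u ↦ y_u` is passive. -/
theorem prop1_unactuated
    {s m : ℕ} (hs : 1 ≤ s) (hm : 1 ≤ m)
    (muu : (Fin s → ℝ) → Matrix (Fin s) (Fin s) ℝ)
    (mau : (Fin s → ℝ) → Matrix (Fin m) (Fin s) ℝ)
    (maa : Matrix (Fin m) (Fin m) ℝ)
    (hmuu : ∀ i j, ContDiff ℝ (⊤ : ℕ∞) fun x => muu x i j)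
    (hmau : ∀ i j, ContDiff ℝ (⊤ : ℕ∞) fun x => mau x i j)
    (hmaa : maa.IsSymm)
    (hM : ∀ qu, (Mblk muu mau maa qu).PosDef)
    (Vu : (Fin s → ℝ) → ℝ) (Va : (Fin m → ℝ) → ℝ)
    (hVu : ContDiff ℝ (⊤ : ℕ∞) Vu) (hVa : ContDiff ℝ (⊤ : ℕ∞) Va)
    (hVubdd : ∃ c : ℝ, ∀ x, c ≤ Vu x)
    (q qd qdd : ℝ → (Fin s ⊕ Fin m) → ℝ)
    (τ : ℝ → Fin m → ℝ) (hτ : ContinuousOn τ (Ici 0))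
    (hq : ∀ t ∈ Ici (0:ℝ), HasDerivWithinAt q (qd t) (Ici 0) t)
    (hqd : ∀ t ∈ Ici (0:ℝ), HasDerivWithinAt qd (qdd t) (Ici 0) t)
    (hqdd : ContinuousOn qdd (Ici 0))
    (hEL : ∀ t ∈ Ici (0:ℝ),
      Mblk muu mau maa (q t ∘ Sum.inl) *ᵥ qdd t
        + Cvec muu mau maa (q t) (qd t)
        + Sum.elim (grad Vu (q t ∘ Sum.inl)) (grad Va (q t ∘ Sum.inr))
      = Sum.elim (0 : Fin s → ℝ) (τ t))
 :
    (∀ t ∈ Ici (0:ℝ),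
      HasDerivWithinAt
        (fun t => Hu muu mau maa Vu (q t ∘ Sum.inl) (qd t ∘ Sum.inl))
        ((τ t - grad Va (q t ∘ Sum.inr)) ⬝ᵥ yU mau maa (q t ∘ Sum.inl) (qd t ∘ Sum.inl))
        (Ici 0) t)
    ∧ ∃ β : ℝ, ∀ t ∈ Ici (0:ℝ),
        β ≤ ∫ σ in (0:ℝ)..t,
          (τ σ - grad Va (q σ ∘ Sum.inr)) ⬝ᵥ yU mau maa (q σ ∘ Sum.inl) (qd σ ∘ Sum.inl) := by
  have hN := differentiable_Mblk_apply (maa := maa) hmuu hmau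
  have hdet : IsUnit maa.det := (isUnit_iff_isUnit_det _).1 (maa_posDef hM).isUnit
  have hderiv : ∀ t ∈ Ici (0:ℝ),
      HasDerivWithinAt
        (fun t => Hu muu mau maa Vu (q t ∘ Sum.inl) (qd t ∘ Sum.inl))
        ((τ t - grad Va (q t ∘ Sum.inr)) ⬝ᵥ yU mau maa (q t ∘ Sum.inl) (qd t ∘ Sum.inl))
        (Ici 0) t := by
    intro t ht
    have hP := hasDerivWithinAt_momentum (maa := maa) hN (hq t ht) (hqd t ht)
    have hE := hEL t ht
    set P : ℝ → (Fin s ⊕ Fin m) → ℝ :=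
      fun r => Mblk muu mau maa (q r ∘ Sum.inl) *ᵥ qd r with hPdef
    -- the actuated momentum obeys `ẇ = u`
    have hw : HasDerivWithinAt (fun r => P r ∘ Sum.inr) (τ t - grad Va (q t ∘ Sum.inr))
        (Ici 0) t := by
      refine hasDerivWithinAt_pi.2 fun k => ?_
      have h := hasDerivWithinAt_pi.1 hP (Sum.inr k)
      have hk := congrFun hE (Sum.inr k)
      simp only [Pi.add_apply, Sum.elim_inr, Cvec_inr hN] at hk
      refine h.congr_deriv ?_
      simp only [Pi.add_apply, Pi.sub_apply]
      linarith
    have hqu : HasDerivWithinAt (fun r => q r ∘ Sum.inl) (qd t ∘ Sum.inl) (Ici 0) t :=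
      (unactuatedProj s m).hasFDerivAt.comp_hasDerivWithinAt t (hq t ht)
    have hV := ((hVu.differentiable (by simp)).differentiableAt
      (x := q t ∘ Sum.inl)).hasFDerivAt.comp_hasDerivWithinAt t hqu
    have hH := ((((hqd t ht).dotProduct hP).sub
      (hw.dotProduct (hw.const_mulVec maa⁻¹))).const_mul (1 / 2 : ℝ)).add hV
    have hfun : (fun t => Hu muu mau maa Vu (q t ∘ Sum.inl) (qd t ∘ Sum.inl)) =
        fun r => (1 / 2 : ℝ) * (qd r ⬝ᵥ P r - (P r ∘ Sum.inr) ⬝ᵥ maa⁻¹ *ᵥ (P r ∘ Sum.inr))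
          + Vu (q r ∘ Sum.inl) := by
      funext r
      rw [Hu, dotProduct_muuS hM hmaa]
    rw [hfun]
    refine hH.congr_deriv ?_
    have hMs : (Mblk muu mau maa (q t ∘ Sum.inl))ᵀ = Mblk muu mau maa (q t ∘ Sum.inl) := by
      simpa using (hM (q t ∘ Sum.inl)).isHermitian.eq
    have hsymm : qdd t ⬝ᵥ P t = qd t ⬝ᵥ Mblk muu mau maa (q t ∘ Sum.inl) *ᵥ qdd t := by
      rw [hPdef, dotProduct_comm, dotProduct_mulVec, ← mulVec_transpose, hMs]
    have hDs : maa⁻¹ᵀ = maa⁻¹ := by rw [transpose_nonsing_inv, hmaa.eq]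
    have hDsymm : (P t ∘ Sum.inr) ⬝ᵥ maa⁻¹ *ᵥ (τ t - grad Va (q t ∘ Sum.inr))
        = (τ t - grad Va (q t ∘ Sum.inr)) ⬝ᵥ maa⁻¹ *ᵥ (P t ∘ Sum.inr) := by
      rw [dotProduct_comm (τ t - _), dotProduct_mulVec, ← mulVec_transpose, hDs]
    -- the power balance of the full system
    have hpow := congrArg (fun z => qd t ⬝ᵥ z) hE
    have hsplit : ∀ (a : Fin s → ℝ) (b : Fin m → ℝ), qd t ⬝ᵥ Sum.elim a b
        = a ⬝ᵥ (qd t ∘ Sum.inl) + b ⬝ᵥ (qd t ∘ Sum.inr) := by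
      intro a b
      rw [← Sum.elim_comp_inl_inr (qd t), sumElim_dotProduct_sumElim, Sum.elim_comp_inl,
        Sum.elim_comp_inr, dotProduct_comm a, dotProduct_comm b]
    simp only [dotProduct_add, dotProduct_Cvec, hsplit, grad_dotProduct Vu,
      zero_dotProduct] at hpow
    have hy : maa⁻¹ *ᵥ (P t ∘ Sum.inr)
        = qd t ∘ Sum.inr - yU mau maa (q t ∘ Sum.inl) (qd t ∘ Sum.inl) := by
      have : P t ∘ Sum.inr
          = mau (q t ∘ Sum.inl) *ᵥ (qd t ∘ Sum.inl) + maa *ᵥ (qd t ∘ Sum.inr) := by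
        simp only [hPdef, Mblk, fromBlocks_mulVec, Sum.elim_comp_inr]
      rw [this, mulVec_add, mulVec_mulVec _ maa⁻¹ maa, nonsing_inv_mul _ hdet, one_mulVec, yU]
      abel
    rw [hDsymm, hsymm, hy]
    simp only [dotProduct_add, dotProduct_sub, sub_dotProduct] at hpow ⊢
    linarith
  refine ⟨hderiv, ?_⟩
  obtain ⟨c, hc⟩ := hVubdd
  refine ⟨c - Hu muu mau maa Vu (q 0 ∘ Sum.inl) (qd 0 ∘ Sum.inl), fun t ht => ?_⟩
  have hqc : ContinuousOn q (Ici 0) := fun r hr => (hq r hr).continuousWithinAt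
  have hqdc : ContinuousOn qd (Ici 0) := fun r hr => (hqd r hr).continuousWithinAt
  have hcont : ContinuousOn (fun σ => (τ σ - grad Va (q σ ∘ Sum.inr)) ⬝ᵥ
      yU mau maa (q σ ∘ Sum.inl) (qd σ ∘ Sum.inl)) (Ici 0) :=
    continuousOn_supplyRate hmau hVa hqc hqdc hτ
  have hint := intervalIntegral.integral_eq_sub_of_hasDeriv_right_of_le ht
    (fun r hr => ((hderiv r hr.1).continuousWithinAt).mono Icc_subset_Ici_self)
    (fun r hr => (hderiv r hr.1.le).mono fun z hz => hr.1.le.trans (le_of_lt hz))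
    ((hcont.mono (by rw [uIcc_of_le ht]; exact Icc_subset_Ici_self)).intervalIntegrable)
  rw [hint]
  exact sub_le_sub_right (le_Hu hM hc _ _) _
end
end

section
/- Along any trajectory of the mechanical system with inner-loop control u(t) := τ(t) − ∇V_a(q_a(t)), the unactuated dynamics reduce to m_uu^s(q_u) q̈_u = m_au(q_u)ᵀ m_aa⁻¹ [ A'(q_u, q̇_u) q̇_u − u ] − [ C_mu(q_u, q̇_u) q̇_u + D_mu(q_u, q̇) + ∇V_u(q_u) ] for all t ≥ 0, where m_uu^s(q_u) := m_uu(q_u) − m_au(q_u)ᵀ m_aa⁻¹ m_au(q_u) is the Schur complement. -/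
open Matrix Set Filter

noncomputable section

/-- Jacobian `A(q_u, v)` of `q_u ↦ m_uu(q_u) v`. -/
def Amat {s : ℕ} (muu : (Fin s → ℝ) → Matrix (Fin s) (Fin s) ℝ) (qu v : Fin s → ℝ) :
    Matrix (Fin s) (Fin s) ℝ :=
  fun i j => fderiv ℝ (fun x => (muu x *ᵥ v) i) qu (Pi.single j 1)

/-- Jacobian `A'(q_u, v)` of `q_u ↦ m_au(q_u) v`. -/
def Aprime {s m : ℕ} (mau : (Fin s → ℝ) → Matrix (Fin m) (Fin s) ℝ) (qu v : Fin s → ℝ) :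
    Matrix (Fin m) (Fin s) ℝ :=
  fun i j => fderiv ℝ (fun x => (mau x *ᵥ v) i) qu (Pi.single j 1)

/-- Jacobian `B(q_u, w)` of `q_u ↦ m_au(q_u)ᵀ w`. -/
def Bmat {s m : ℕ} (mau : (Fin s → ℝ) → Matrix (Fin m) (Fin s) ℝ)
    (qu : Fin s → ℝ) (w : Fin m → ℝ) : Matrix (Fin s) (Fin s) ℝ :=
  fun i j => fderiv ℝ (fun x => ((mau x)ᵀ *ᵥ w) i) qu (Pi.single j 1)

/-- `C_mu(q_u, v) = A(q_u, v) − ½ A(q_u, v)ᵀ`. -/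
def Cmu {s : ℕ} (muu : (Fin s → ℝ) → Matrix (Fin s) (Fin s) ℝ) (qu v : Fin s → ℝ) :
    Matrix (Fin s) (Fin s) ℝ :=
  Amat muu qu v - (1/2 : ℝ) • (Amat muu qu v)ᵀ

/-- `D_mu(q_u, (v, w)) = B(q_u, w) v − A'(q_u, v)ᵀ w`. -/
def Dmu {s m : ℕ} (mau : (Fin s → ℝ) → Matrix (Fin m) (Fin s) ℝ)
    (qu v : Fin s → ℝ) (w : Fin m → ℝ) : Fin s → ℝ :=
  Bmat mau qu w *ᵥ v - (Aprime mau qu v)ᵀ *ᵥ w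

/-- The chain rule for a function of the unactuated coordinates only. -/
theorem fderiv_comp_inl {s m : ℕ} {f : (Fin s → ℝ) → ℝ} (q v : (Fin s ⊕ Fin m) → ℝ)
    (hf : DifferentiableAt ℝ f (q ∘ Sum.inl)) :
    fderiv ℝ (fun p : (Fin s ⊕ Fin m) → ℝ => f (p ∘ Sum.inl)) q v
      = fderiv ℝ f (q ∘ Sum.inl) (v ∘ Sum.inl) := by
  let L : ((Fin s ⊕ Fin m) → ℝ) →L[ℝ] (Fin s → ℝ) :=
    ContinuousLinearMap.pi fun i => ContinuousLinearMap.proj (Sum.inl i)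
  have hL : HasFDerivAt (fun p => f (L p)) ((fderiv ℝ f (L q)).comp L) q :=
    HasFDerivAt.comp q (g := f) (f := L) hf.hasFDerivAt L.hasFDerivAt
  exact congrArg (fun T => T v) hL.fderiv

theorem single_inl_comp_inl {s m : ℕ} (j : Fin s) :
    (Pi.single (Sum.inl j) 1 : (Fin s ⊕ Fin m) → ℝ) ∘ Sum.inl = Pi.single j 1 := by
  ext i
  simp [Pi.single_apply]

theorem single_inr_comp_inl {s m : ℕ} (j : Fin m) :
    (Pi.single (Sum.inr j) 1 : (Fin s ⊕ Fin m) → ℝ) ∘ Sum.inl = 0 := by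
  ext i
  simp

theorem differentiableAt_mulVec_apply {k s m : ℕ} {N : (Fin k → ℝ) → Matrix (Fin m) (Fin s) ℝ}
    (hN : ∀ i j, Differentiable ℝ fun x => N x i j) (v : Fin s → ℝ) (i : Fin m)
    (x : Fin k → ℝ) : DifferentiableAt ℝ (fun x => (N x *ᵥ v) i) x := by
  simp only [Matrix.mulVec, dotProduct]
  exact DifferentiableAt.fun_sum fun j _ => (hN i j x).mul_const _

/-- Block form of the Jacobian of `q ↦ M(q_u) v`. -/
theorem Jmat_eq_fromBlocks {s m : ℕ} {muu : (Fin s → ℝ) → Matrix (Fin s) (Fin s) ℝ}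
    {mau : (Fin s → ℝ) → Matrix (Fin m) (Fin s) ℝ} (maa : Matrix (Fin m) (Fin m) ℝ)
    (hmuu : ∀ i j, Differentiable ℝ fun x => muu x i j)
    (hmau : ∀ i j, Differentiable ℝ fun x => mau x i j) (q v : (Fin s ⊕ Fin m) → ℝ) :
    Jmat muu mau maa q v = Matrix.fromBlocks
      (Amat muu (q ∘ Sum.inl) (v ∘ Sum.inl) + Bmat mau (q ∘ Sum.inl) (v ∘ Sum.inr)) 0
      (Aprime mau (q ∘ Sum.inl) (v ∘ Sum.inl)) 0 := by
  have hA := fun i => differentiableAt_mulVec_apply hmuu (v ∘ Sum.inl) i (q ∘ Sum.inl)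
  have hB := fun i => differentiableAt_mulVec_apply (N := fun x => (mau x)ᵀ)
    (fun i j => hmau j i) (v ∘ Sum.inr) i (q ∘ Sum.inl)
  have hA' := fun i => differentiableAt_mulVec_apply hmau (v ∘ Sum.inl) i (q ∘ Sum.inl)
  have hu : ∀ i w, fderiv ℝ (fun p : (Fin s ⊕ Fin m) → ℝ =>
      (Mblk muu mau maa (p ∘ Sum.inl) *ᵥ v) (Sum.inl i)) q w
      = fderiv ℝ (fun x => (muu x *ᵥ (v ∘ Sum.inl)) i) (q ∘ Sum.inl) (w ∘ Sum.inl)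
        + fderiv ℝ (fun x => ((mau x)ᵀ *ᵥ (v ∘ Sum.inr)) i) (q ∘ Sum.inl) (w ∘ Sum.inl) := by
    intro i w
    simp only [Mblk, Matrix.fromBlocks_mulVec, Sum.elim_inl, Pi.add_apply]
    rw [fderiv_comp_inl (f := fun x => (muu x *ᵥ (v ∘ Sum.inl)) i
      + ((mau x)ᵀ *ᵥ (v ∘ Sum.inr)) i) q w ((hA i).fun_add (hB i)), fderiv_fun_add (hA i) (hB i)]
    rfl
  have ha : ∀ i w, fderiv ℝ (fun p : (Fin s ⊕ Fin m) → ℝ =>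
      (Mblk muu mau maa (p ∘ Sum.inl) *ᵥ v) (Sum.inr i)) q w
      = fderiv ℝ (fun x => (mau x *ᵥ (v ∘ Sum.inl)) i) (q ∘ Sum.inl) (w ∘ Sum.inl) := by
    intro i w
    simp only [Mblk, Matrix.fromBlocks_mulVec, Sum.elim_inr, Pi.add_apply]
    rw [fderiv_comp_inl (f := fun x => (mau x *ᵥ (v ∘ Sum.inl)) i
      + (maa *ᵥ (v ∘ Sum.inr)) i) q w ((hA' i).add_const _), fderiv_add_const]
  ext (i | i) (j | j)
  · simp only [Jmat, hu, single_inl_comp_inl]; rfl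
  · simp only [Jmat, hu, single_inr_comp_inl]; simp
  · simp only [Jmat, ha, single_inl_comp_inl]; rfl
  · simp only [Jmat, ha, single_inr_comp_inl]; simp

/-- Both sides are the gradient of `q_u ↦ wᵀ m_au(q_u) v`. -/
theorem transpose_Bmat_mulVec {s m : ℕ} {mau : (Fin s → ℝ) → Matrix (Fin m) (Fin s) ℝ}
    (hmau : ∀ i j, Differentiable ℝ fun x => mau x i j) (qu v : Fin s → ℝ) (w : Fin m → ℝ) :
    (Bmat mau qu w)ᵀ *ᵥ v = (Aprime mau qu v)ᵀ *ᵥ w := by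
  have hB : ∀ i j, Bmat mau qu w i j
      = ∑ k, fderiv ℝ (fun x => mau x k i) qu (Pi.single j 1) * w k := by
    intro i j
    simp only [Bmat, Matrix.mulVec, dotProduct, Matrix.transpose_apply]
    rw [fderiv_fun_sum fun k _ => (hmau k i qu).mul_const _]
    simp [fderiv_mul_const (hmau _ _ qu), mul_comm]
  have hA : ∀ k j, Aprime mau qu v k j
      = ∑ i, fderiv ℝ (fun x => mau x k i) qu (Pi.single j 1) * v i := by
    intro k j
    simp only [Aprime, Matrix.mulVec, dotProduct]
    rw [fderiv_fun_sum fun i _ => (hmau k i qu).mul_const _]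
    simp [fderiv_mul_const (hmau _ _ qu), mul_comm]
  ext j
  simp only [Matrix.mulVec, dotProduct, Matrix.transpose_apply, hA, hB, Finset.sum_mul]
  rw [Finset.sum_comm]
  exact Finset.sum_congr rfl fun k _ => Finset.sum_congr rfl fun i _ => mul_right_comm _ _ _

/-- The Coriolis force split into its unactuated and actuated components. -/
theorem Cvec_eq_elim {s m : ℕ} {muu : (Fin s → ℝ) → Matrix (Fin s) (Fin s) ℝ}
    {mau : (Fin s → ℝ) → Matrix (Fin m) (Fin s) ℝ} (maa : Matrix (Fin m) (Fin m) ℝ)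
    (hmuu : ∀ i j, Differentiable ℝ fun x => muu x i j)
    (hmau : ∀ i j, Differentiable ℝ fun x => mau x i j) (q v : (Fin s ⊕ Fin m) → ℝ) :
    Cvec muu mau maa q v = Sum.elim
      (Cmu muu (q ∘ Sum.inl) (v ∘ Sum.inl) *ᵥ (v ∘ Sum.inl)
        + Dmu mau (q ∘ Sum.inl) (v ∘ Sum.inl) (v ∘ Sum.inr))
      (Aprime mau (q ∘ Sum.inl) (v ∘ Sum.inl) *ᵥ (v ∘ Sum.inl)) := by
  have hBA := transpose_Bmat_mulVec hmau (q ∘ Sum.inl) (v ∘ Sum.inl) (v ∘ Sum.inr)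
  rw [Cvec, Jmat_eq_fromBlocks maa hmuu hmau, Matrix.sub_mulVec, Matrix.smul_mulVec,
    Matrix.fromBlocks_transpose, Matrix.fromBlocks_mulVec, Matrix.fromBlocks_mulVec]
  ext (i | i)
  · simp only [Cmu, Dmu, Matrix.sub_mulVec, Matrix.smul_mulVec, Matrix.add_mulVec,
      Matrix.transpose_add, hBA, Pi.add_apply, Pi.sub_apply, Pi.smul_apply, Sum.elim_inl,
      Matrix.zero_mulVec, Pi.zero_apply, smul_eq_mul]
    ring
  · simp

/-- Eliminating `y` from a block linear system by means of the Schur complement. -/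
theorem schur_mulVec_eq {s m : ℕ} {U : Matrix (Fin s) (Fin s) ℝ} {N : Matrix (Fin m) (Fin s) ℝ}
    {K : Matrix (Fin m) (Fin m) ℝ} (hK : IsUnit K.det) {x a : Fin s → ℝ} {y b : Fin m → ℝ}
    (hu : U *ᵥ x + Nᵀ *ᵥ y = a) (ha : N *ᵥ x + K *ᵥ y = b) :
    (U - Nᵀ * K⁻¹ * N) *ᵥ x = a - (Nᵀ * K⁻¹) *ᵥ b := by
  rw [← hu, ← ha, Matrix.mulVec_add, Matrix.mulVec_mulVec, Matrix.mulVec_mulVec,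
    Matrix.mul_assoc Nᵀ K⁻¹ K, Matrix.nonsing_inv_mul K hK, Matrix.mul_one, Matrix.sub_mulVec]
  abel

/-- along any trajectory with inner-loop control `u = τ − ∇V_a(q_a)`, the
unactuated dynamics reduce to
`m_uu^s q̈_u = m_auᵀ m_aa⁻¹ [A'(q_u, q̇_u) q̇_u − u] − [C_mu q̇_u + D_mu + ∇V_u]`. -/
theorem reduced_unactuated_dynamics
    {s m : ℕ} (hs : 1 ≤ s) (hm : 1 ≤ m)
    (muu : (Fin s → ℝ) → Matrix (Fin s) (Fin s) ℝ)
    (mau : (Fin s → ℝ) → Matrix (Fin m) (Fin s) ℝ)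
    (maa : Matrix (Fin m) (Fin m) ℝ)
    (hmuu : ∀ i j, ContDiff ℝ (⊤ : ℕ∞) fun x => muu x i j)
    (hmau : ∀ i j, ContDiff ℝ (⊤ : ℕ∞) fun x => mau x i j)
    (hmaa : maa.IsSymm)
    (hM : ∀ qu, (Mblk muu mau maa qu).PosDef)
    (Vu : (Fin s → ℝ) → ℝ) (Va : (Fin m → ℝ) → ℝ)
    (hVu : ContDiff ℝ (⊤ : ℕ∞) Vu) (hVa : ContDiff ℝ (⊤ : ℕ∞) Va)
    (q qd qdd : ℝ → (Fin s ⊕ Fin m) → ℝ)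
    (τ : ℝ → Fin m → ℝ) (hτ : ContinuousOn τ (Ici 0))
    (hq : ∀ t ∈ Ici (0:ℝ), HasDerivWithinAt q (qd t) (Ici 0) t)
    (hqd : ∀ t ∈ Ici (0:ℝ), HasDerivWithinAt qd (qdd t) (Ici 0) t)
    (hqdd : ContinuousOn qdd (Ici 0))
    (hEL : ∀ t ∈ Ici (0:ℝ),
      Mblk muu mau maa (q t ∘ Sum.inl) *ᵥ qdd t
        + Cvec muu mau maa (q t) (qd t)
        + Sum.elim (grad Vu (q t ∘ Sum.inl)) (grad Va (q t ∘ Sum.inr))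
      = Sum.elim (0 : Fin s → ℝ) (τ t))
 :
    ∀ t ∈ Ici (0:ℝ),
      muuS muu mau maa (q t ∘ Sum.inl) *ᵥ (qdd t ∘ Sum.inl)
        = ((mau (q t ∘ Sum.inl))ᵀ * maa⁻¹) *ᵥ
            (Aprime mau (q t ∘ Sum.inl) (qd t ∘ Sum.inl) *ᵥ (qd t ∘ Sum.inl)
              - (τ t - grad Va (q t ∘ Sum.inr)))
          - (Cmu muu (q t ∘ Sum.inl) (qd t ∘ Sum.inl) *ᵥ (qd t ∘ Sum.inl)
              + Dmu mau (q t ∘ Sum.inl) (qd t ∘ Sum.inl) (qd t ∘ Sum.inr)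
              + grad Vu (q t ∘ Sum.inl)) := by
  intro t ht
  have hK : IsUnit maa.det := by
    have h : maa.PosDef := (hM 0).submatrix Sum.inr_injective
    exact h.det_pos.ne'.isUnit
  have hE := hEL t ht
  rw [Cvec_eq_elim maa (fun i j => (hmuu i j).differentiable (by simp))
    (fun i j => (hmau i j).differentiable (by simp)), Mblk, Matrix.fromBlocks_mulVec] at hE
  have hu := congrArg (· ∘ Sum.inl) hE
  have ha := congrArg (· ∘ Sum.inr) hE
  simp only [Pi.add_comp, Sum.elim_comp_inl, Sum.elim_comp_inr, add_assoc] at hu ha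
  rw [muuS, schur_mulVec_eq hK
    (eq_neg_of_add_eq_zero_left ((add_assoc _ _ _).trans hu))
    (eq_sub_of_add_eq ((add_assoc _ _ _).trans ha)), ← neg_sub (τ t - _) (Aprime _ _ _ *ᵥ _),
    Matrix.mulVec_neg, sub_sub, add_comm (grad Va _), ← add_assoc]
  abel
end
end

section
/- (Lemma 2) Let y : [0, ∞) → ℝᵐ be C¹, let z₀ ∈ ℝᵐ, and set z(t) := z₀ + ∫₀ᵗ y(s) ds. Define v(t) := K_P y(t) + K_I z(t) + K_D ẏ(t). Then for all t ≥ 0, ∫₀ᵗ y(s)ᵀ v(s) ds ≥ λ_min(K_P) ∫₀ᵗ |y(s)|² ds − ½ z₀ᵀ K_I z₀ − ½ y(0)ᵀ K_D y(0), where λ_min(K_P) > 0 is the smallest eigenvalue of K_P. In particular the PID operator y ↦ v is input strictly passive. -/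
open Matrix Set Filter

noncomputable section

/-- A real symmetric quadratic form is bounded below by its smallest eigenvalue. -/
theorem iInf_eigenvalues_mul_dotProduct_le {n : Type*} [Fintype n] [DecidableEq n]
    {A : Matrix n n ℝ} (hA : A.IsHermitian) (x : n → ℝ) :
    (⨅ i, hA.eigenvalues i) * (x ⬝ᵥ x) ≤ x ⬝ᵥ A *ᵥ x := by
  set c := ⨅ i, hA.eigenvalues i
  have hdiag : (diagonal fun i => hA.eigenvalues i - c).PosSemidef :=
    .diagonal fun i => sub_nonneg.2 (ciInf_le (Set.finite_range _).bddBelow i)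
  have hshift : A - c • (1 : Matrix n n ℝ) =
      (hA.eigenvectorUnitary : Matrix n n ℝ) * (diagonal fun i => hA.eigenvalues i - c) *
        (hA.eigenvectorUnitary : Matrix n n ℝ)ᴴ := by
    have hU : (hA.eigenvectorUnitary : Matrix n n ℝ) *
        (hA.eigenvectorUnitary : Matrix n n ℝ)ᴴ = 1 :=
      Unitary.coe_mul_star_self hA.eigenvectorUnitary
    have hspec := hA.spectral_theorem
    rw [Unitary.conjStarAlgAut_apply] at hspec
    have hsub : (diagonal fun i => hA.eigenvalues i - c) =
        Matrix.diagonal (RCLike.ofReal ∘ hA.eigenvalues) - c • (1 : Matrix n n ℝ) := by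
      rw [smul_one_eq_diagonal, diagonal_sub]
      rfl
    rw [hsub, mul_sub, sub_mul, mul_smul_comm, smul_mul_assoc, mul_one, hU]
    exact congrArg (· - c • (1 : Matrix n n ℝ)) hspec
  have hnonneg := (hdiag.mul_mul_conjTranspose_same
    (hA.eigenvectorUnitary : Matrix n n ℝ)).dotProduct_mulVec_nonneg x
  rw [← hshift] at hnonneg
  simpa [sub_mulVec, smul_mulVec] using hnonneg

/-- The derivative of `½ uᵀ K u` is `uᵀ K u'` when `K` is symmetric. -/
theorem HasDerivWithinAt.half_dotProduct_mulVec {n : Type*} [Fintype n]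
    {K : Matrix n n ℝ} (hK : K.IsHermitian) {u : ℝ → n → ℝ} {u' : n → ℝ} {s : Set ℝ} {t : ℝ}
    (hu : HasDerivWithinAt u u' s t) :
    HasDerivWithinAt (fun τ => (1 / 2 : ℝ) * (u τ ⬝ᵥ K *ᵥ u τ)) (u t ⬝ᵥ K *ᵥ u') s t := by
  have hcoord := hasDerivWithinAt_pi.1 hu
  have hKu : ∀ i, HasDerivWithinAt (fun τ => (K *ᵥ u τ) i) ((K *ᵥ u') i) s t := fun i =>
    HasDerivWithinAt.fun_sum fun j _ => (hcoord j).const_mul (K i j)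
  have hdot : HasDerivWithinAt (fun τ => u τ ⬝ᵥ K *ᵥ u τ)
      (∑ i, (u' i * (K *ᵥ u t) i + u t i * (K *ᵥ u') i)) s t :=
    HasDerivWithinAt.fun_sum fun i _ => (hcoord i).mul (hKu i)
  refine (hdot.const_mul (1 / 2 : ℝ)).congr_deriv ?_
  have hsymm : u' ⬝ᵥ K *ᵥ u t = u t ⬝ᵥ K *ᵥ u' := by
    rw [dotProduct_mulVec, ← mulVec_transpose, dotProduct_comm,
      show Kᵀ = K from hK]
  rw [Finset.sum_add_distrib]
  change (1 / 2 : ℝ) * (u' ⬝ᵥ K *ᵥ u t + u t ⬝ᵥ K *ᵥ u') = _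
  rw [hsymm]
  ring

theorem ContinuousOn.dotProduct_mulVec {α n : Type*} [TopologicalSpace α] [Fintype n]
    {u v : α → n → ℝ} {s : Set α} (hu : ContinuousOn u s) (K : Matrix n n ℝ)
    (hv : ContinuousOn v s) : ContinuousOn (fun τ => u τ ⬝ᵥ K *ᵥ v τ) s := by
  rw [continuousOn_iff_continuous_domRestrict] at *
  exact hu.dotProduct (continuous_const.matrix_mulVec hv)

/-- Fundamental theorem of calculus for `½ uᵀ K u` with `K` symmetric. -/
theorem integral_dotProduct_mulVec_deriv {n : Type*} [Fintype n]
    {K : Matrix n n ℝ} (hK : K.IsHermitian) {u u' : ℝ → n → ℝ} {a b : ℝ} (hab : a ≤ b)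
    (hu : ContinuousOn u (Icc a b))
    (hderiv : ∀ t ∈ Ioo a b, HasDerivWithinAt u (u' t) (Ioi t) t)
    (hu' : ContinuousOn u' (Icc a b)) :
    ∫ t in a..b, u t ⬝ᵥ K *ᵥ u' t =
      (1 / 2 : ℝ) * (u b ⬝ᵥ K *ᵥ u b) - (1 / 2 : ℝ) * (u a ⬝ᵥ K *ᵥ u a) :=
  intervalIntegral.integral_eq_sub_of_hasDeriv_right_of_le hab
    (continuousOn_const.mul (hu.dotProduct_mulVec K hu))
    (fun t ht => (hderiv t ht).half_dotProduct_mulVec hK)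
    ((hu.dotProduct_mulVec K hu').intervalIntegrable_of_Icc hab)

/-- Lemma 2: the PID operator `y ↦ v = K_P y + K_I z + K_D ẏ`, with
`z(t) = z₀ + ∫₀ᵗ y`, is input strictly passive:
`∫₀ᵗ yᵀ v ≥ λ_min(K_P) ∫₀ᵗ |y|² − ½ z₀ᵀ K_I z₀ − ½ y(0)ᵀ K_D y(0)`. -/
theorem lemma2_pid_isp
    {m : ℕ} (hm : 1 ≤ m)
    (KP KI KD : Matrix (Fin m) (Fin m) ℝ)
    (hKP : KP.PosDef) (hKI : KI.PosDef) (hKD : KD.PosSemidef)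
    (y yd : ℝ → Fin m → ℝ) (z₀ : Fin m → ℝ)
    (hy : ∀ t ∈ Ici (0:ℝ), HasDerivWithinAt y (yd t) (Ici 0) t)
    (hyd : ContinuousOn yd (Ici 0)) :
    ∀ t ∈ Ici (0:ℝ),
      (⨅ i, hKP.1.eigenvalues i) * (∫ σ in (0:ℝ)..t, y σ ⬝ᵥ y σ)
          - (1/2 : ℝ) * (z₀ ⬝ᵥ KI *ᵥ z₀) - (1/2 : ℝ) * (y 0 ⬝ᵥ KD *ᵥ y 0)
        ≤ ∫ σ in (0:ℝ)..t,
            y σ ⬝ᵥ (KP *ᵥ y σ + KI *ᵥ (z₀ + ∫ r in (0:ℝ)..σ, y r) + KD *ᵥ yd σ) := by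
  intro t ht
  have ht0 : (0 : ℝ) ≤ t := ht
  have hsub : Icc 0 t ⊆ Ici (0 : ℝ) := Icc_subset_Ici_self
  have hyIci : ContinuousOn y (Ici 0) := fun τ hτ => (hy τ hτ).continuousWithinAt
  have hyc : ContinuousOn y (Icc 0 t) := hyIci.mono hsub
  have hydc : ContinuousOn yd (Icc 0 t) := hyd.mono hsub
  set z : ℝ → Fin m → ℝ := fun σ => z₀ + ∫ r in (0:ℝ)..σ, y r with hz
  have hzc : ContinuousOn z (Icc 0 t) := by
    have hprim := intervalIntegral.continuousOn_primitive_interval (a := 0) (b := t)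
      (f := y) (μ := MeasureTheory.volume)
      (by rw [uIcc_of_le ht0]; exact hyc.integrableOn_Icc)
    rw [uIcc_of_le ht0] at hprim
    exact continuousOn_const.add hprim
  have hzderiv : ∀ σ ∈ Ioo 0 t, HasDerivWithinAt z (y σ) (Ioi σ) σ := fun σ hσ =>
    ((intervalIntegral.integral_hasDerivAt_right
      ((hyIci.mono Icc_subset_Ici_self).intervalIntegrable_of_Icc hσ.1.le)
      ((hyIci.mono Ioi_subset_Ici_self).stronglyMeasurableAtFilter isOpen_Ioi σ hσ.1)
      (hyIci.continuousAt (Ici_mem_nhds hσ.1))).const_add z₀).hasDerivWithinAt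
  have hyderiv : ∀ σ ∈ Ioo 0 t, HasDerivWithinAt y (yd σ) (Ioi σ) σ := fun σ hσ =>
    (hy σ hσ.1.le).mono fun τ hτ => hσ.1.le.trans (le_of_lt hτ)
  have hI := integral_dotProduct_mulVec_deriv hKI.1 ht0 hzc hzderiv hyc
  have hD := integral_dotProduct_mulVec_deriv hKD.1 ht0 hyc hyderiv hydc
  have hsymm : ∀ σ, y σ ⬝ᵥ KI *ᵥ z σ = z σ ⬝ᵥ KI *ᵥ y σ := fun σ => by
    rw [dotProduct_mulVec, ← mulVec_transpose, dotProduct_comm, show KIᵀ = KI from hKI.1]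
  have hPint := (hyc.dotProduct_mulVec KP hyc).intervalIntegrable_of_Icc
    (μ := MeasureTheory.volume) ht0
  have hIint := (hzc.dotProduct_mulVec KI hyc).intervalIntegrable_of_Icc
    (μ := MeasureTheory.volume) ht0
  have hDint := (hyc.dotProduct_mulVec KD hydc).intervalIntegrable_of_Icc
    (μ := MeasureTheory.volume) ht0
  have hsplit : ∫ σ in (0:ℝ)..t, y σ ⬝ᵥ (KP *ᵥ y σ + KI *ᵥ z σ + KD *ᵥ yd σ) =
      (∫ σ in (0:ℝ)..t, y σ ⬝ᵥ KP *ᵥ y σ) + (∫ σ in (0:ℝ)..t, z σ ⬝ᵥ KI *ᵥ y σ) +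
        ∫ σ in (0:ℝ)..t, y σ ⬝ᵥ KD *ᵥ yd σ := by
    simp only [dotProduct_add, hsymm]
    rw [intervalIntegral.integral_add (hPint.add hIint) hDint,
      intervalIntegral.integral_add hPint hIint]
  have hyy : IntervalIntegrable (fun σ => y σ ⬝ᵥ y σ) MeasureTheory.volume 0 t := by
    simpa using (hyc.dotProduct_mulVec 1 hyc).intervalIntegrable_of_Icc
      (μ := MeasureTheory.volume) ht0
  have hP : (⨅ i, hKP.1.eigenvalues i) * (∫ σ in (0:ℝ)..t, y σ ⬝ᵥ y σ) ≤
      ∫ σ in (0:ℝ)..t, y σ ⬝ᵥ KP *ᵥ y σ := by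
    rw [← intervalIntegral.integral_const_mul]
    exact intervalIntegral.integral_mono_on ht0 (hyy.const_mul _) hPint
      fun σ _ => iInf_eigenvalues_mul_dotProduct_le hKP.1 (y σ)
  have hIt : 0 ≤ z t ⬝ᵥ KI *ᵥ z t := by
    simpa using hKI.posSemidef.dotProduct_mulVec_nonneg (z t)
  have hDt : 0 ≤ y t ⬝ᵥ KD *ᵥ y t := by simpa using hKD.dotProduct_mulVec_nonneg (y t)
  have hz0 : z 0 = z₀ := by simp [hz]
  rw [hz0] at hI
  rw [hsplit, hI, hD]
  linarith
end
end

section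
/- For all q_u ∈ ℝˢ and q̇ = (v, w) ∈ ℝˢ × ℝᵐ, with y_d := k_a w + (k_a − k_u) m_aa⁻¹ m_au(q_u) v, the following quadratic-form identity holds: k_e [ k_a H_a(q_u, q̇) + k_u H_u(q_u, v) ] + ½ y_dᵀ K_D y_d = ½ q̇ᵀ M_d(q_u) q̇ + k_e k_u V_u(q_u), where M_d(q_u) is the n×n block matrix with (1,1)-block k_e k_u m_uu^s(q_u) + k_e k_a m_au(q_u)ᵀ m_aa⁻¹ m_au(q_u) + (k_a − k_u)² m_au(q_u)ᵀ m_aa⁻¹ K_D m_aa⁻¹ m_au(q_u), (1,2)-block k_e k_a m_au(q_u)ᵀ + k_a (k_a − k_u) m_au(q_u)ᵀ m_aa⁻¹ K_D, (2,1)-block k_e k_a m_au(q_u) + k_a (k_a − k_u) K_D m_aa⁻¹ m_au(q_u), and (2,2)-block k_e k_a m_aa + k_a² K_D. -/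
open Matrix Set Filter

noncomputable section

/-- The desired inertia matrix `M_d(q_u)`. -/
def MdMat {s m : ℕ} (muu : (Fin s → ℝ) → Matrix (Fin s) (Fin s) ℝ)
    (mau : (Fin s → ℝ) → Matrix (Fin m) (Fin s) ℝ)
    (maa : Matrix (Fin m) (Fin m) ℝ) (KD : Matrix (Fin m) (Fin m) ℝ)
    (ke ka ku : ℝ) (qu : Fin s → ℝ) :
    Matrix (Fin s ⊕ Fin m) (Fin s ⊕ Fin m) ℝ :=
  Matrix.fromBlocks
    ((ke * ku) • muuS muu mau maa qu + (ke * ka) • ((mau qu)ᵀ * maa⁻¹ * mau qu)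
      + ((ka - ku)^2) • ((mau qu)ᵀ * maa⁻¹ * KD * maa⁻¹ * mau qu))
    ((ke * ka) • (mau qu)ᵀ + (ka * (ka - ku)) • ((mau qu)ᵀ * maa⁻¹ * KD))
    ((ke * ka) • mau qu + (ka * (ka - ku)) • (KD * maa⁻¹ * mau qu))
    ((ke * ka) • maa + (ka^2) • KD)

/-- the quadratic-form identity
`k_e[k_a H_a + k_u H_u] + ½ y_dᵀ K_D y_d = ½ q̇ᵀ M_d(q_u) q̇ + k_e k_u V_u(q_u)`. -/
theorem energy_reshaping_identity
    {s m : ℕ} (hs : 1 ≤ s) (hm : 1 ≤ m)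
    (muu : (Fin s → ℝ) → Matrix (Fin s) (Fin s) ℝ)
    (mau : (Fin s → ℝ) → Matrix (Fin m) (Fin s) ℝ)
    (maa : Matrix (Fin m) (Fin m) ℝ)
    (hmuu : ∀ i j, ContDiff ℝ (⊤ : ℕ∞) fun x => muu x i j)
    (hmau : ∀ i j, ContDiff ℝ (⊤ : ℕ∞) fun x => mau x i j)
    (hmaa : maa.IsSymm) (hinv : IsUnit maa)
    (Vu : (Fin s → ℝ) → ℝ) (hVu : ContDiff ℝ (⊤ : ℕ∞) Vu)
    (ke ka ku : ℝ) (hke : ke ≠ 0) (hka : ka ≠ 0) (hku : ku ≠ 0) (hkaku : ka ≠ ku)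
    (KD : Matrix (Fin m) (Fin m) ℝ) (hKD : KD.PosSemidef) :
    ∀ (qu v : Fin s → ℝ) (w : Fin m → ℝ),
      ke * (ka * Ha mau maa qu (Sum.elim v w) + ku * Hu muu mau maa Vu qu v)
        + (1/2 : ℝ) * ((ka • w + (ka - ku) • ((maa⁻¹ * mau qu) *ᵥ v)) ⬝ᵥ
            KD *ᵥ (ka • w + (ka - ku) • ((maa⁻¹ * mau qu) *ᵥ v)))
      = (1/2 : ℝ) * (Sum.elim v w ⬝ᵥ MdMat muu mau maa KD ke ka ku qu *ᵥ Sum.elim v w)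
        + ke * ku * Vu qu := by
  intro qu v w
  have adj : ∀ x : Fin m → ℝ,
      ((maa⁻¹ * mau qu) *ᵥ v) ⬝ᵥ x = v ⬝ᵥ (((mau qu)ᵀ * maa⁻¹) *ᵥ x) := by
    intro x
    rw [dotProduct_comm, dotProduct_mulVec, ← mulVec_transpose, transpose_mul,
      transpose_nonsing_inv, hmaa.eq, dotProduct_comm]
  simp only [Ha, Hu, MaMat, MdMat, fromBlocks_mulVec, sumElim_dotProduct_sumElim,
    Sum.elim_comp_inl, Sum.elim_comp_inr, add_mulVec, smul_mulVec, mulVec_add, mulVec_smul,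
    dotProduct_add, add_dotProduct, dotProduct_smul, smul_dotProduct, adj, mulVec_mulVec,
    smul_eq_mul, Matrix.mul_assoc]
  ring
end
end
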